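/- arXiv:2511.03118 — 3 statements merged into one kernel-verified Lean document; each statement's English description precedes it below -/
import Mathlib

section
/- (One-fold Darboux transformation.) Let ρ ∈ ℝ, let (q,r) be a smooth solution of the coupled system (S), let λ₁, λ₂ ∈ ℂ\{0}, and for k = 1,2 let Φ_k = (φ_{1,k}, φ_{2,k}) be a smooth solution of ∂ₓΦ_k = P(λ_k)Φ_k, ∂ₜΦ_k = Q(λ_k)Φ_k. Assume that λ₂ φ_{1,1} φ_{2,2} − λ₁ φ_{1,2} φ_{2,1} and λ₁ φ_{1,1} φ_{2,2} − λ₂ φ_{1,2} φ_{2,1} are nowhere zero, and define A₂ := (λ₁² − λ₂²) φ_{1,1} φ_{1,2} / (λ₂ φ_{1,1} φ_{2,2} − λ₁ φ_{1,2} φ_{2,1}) and A₃ := (λ₂² − λ₁²) φ_{2,1} φ_{2,2} / (λ₁ φ_{1,1} φ_{2,2} − λ₂ φ_{1,2} φ_{2,1}). Then q[1] := q − 2iρ A₂ + ∂ₓA₂ and r[1] := r + 2iρ A₃ + ∂ₓA₃ again form a smooth solution of the coupled system (S) at every (x,t) ∈ ℝ². -/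
open Complex

/-- Partial derivative in the space variable `x` (first coordinate). -/
noncomputable def pdx (f : ℝ × ℝ → ℂ) : ℝ × ℝ → ℂ :=
  fun p => deriv (fun x => f (x, p.2)) p.1

/-- Partial derivative in the time variable `t` (second coordinate). -/
noncomputable def pdt (f : ℝ × ℝ → ℂ) : ℝ × ℝ → ℂ :=
  fun p => deriv (fun t => f (p.1, t)) p.2

/-- The coupled system (S). -/
def CoupledS (q r : ℝ × ℝ → ℂ) (ρ : ℝ) : Prop :=
  ∀ p : ℝ × ℝ,
    I * pdt q p + I * pdx (pdx (pdx q)) p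
        + (3 * q p * r p + 2 * (ρ : ℂ)) * pdx (pdx q) p
        + 3 * r p * (pdx q p) ^ 2
        + (1 / 2) * (-9 * I * (q p) ^ 2 * (r p) ^ 2 - 20 * I * (ρ : ℂ) * q p * r p
            + 8 * I * (ρ : ℂ) ^ 2 + 6 * q p * pdx r p) * pdx q p
        + I * (-3 * (q p) ^ 3 * r p - 2 * (ρ : ℂ) * (q p) ^ 2) * pdx r p
        - 3 * (ρ : ℂ) * (r p) ^ 2 * (q p) ^ 3
        - 4 * (ρ : ℂ) ^ 2 * r p * (q p) ^ 2
        + 8 * ((ρ : ℂ) ^ 3 - (ρ : ℂ) ^ 2) * q p = 0 ∧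
    I * pdt r p + I * pdx (pdx (pdx r)) p
        - (3 * q p * r p + 2 * (ρ : ℂ)) * pdx (pdx r) p
        - 3 * q p * (pdx r p) ^ 2
        + (1 / 2) * (-9 * I * (q p) ^ 2 * (r p) ^ 2 - 20 * I * (ρ : ℂ) * q p * r p
            + 8 * I * (ρ : ℂ) ^ 2 - 6 * r p * pdx q p) * pdx r p
        + I * (-3 * (r p) ^ 3 * q p - 2 * (ρ : ℂ) * (r p) ^ 2) * pdx q p
        + 3 * (ρ : ℂ) * (r p) ^ 3 * (q p) ^ 2
        + 4 * (ρ : ℂ) ^ 2 * (r p) ^ 2 * q p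
        + 8 * (-(ρ : ℂ) ^ 3 + (ρ : ℂ) ^ 2) * r p = 0

/-- Entry `Q₁` of the Lax matrix `Q(λ)` of the coupled system. -/
noncomputable def Qent1 (q r : ℝ × ℝ → ℂ) (ρ : ℝ) (l : ℂ) (p : ℝ × ℝ) : ℂ :=
  -(3 * I / 2) * (q p) ^ 2 * (r p) ^ 2 / l ^ 2 - 4 * I * (ρ : ℂ) ^ 2
    - pdx r p * q p / l ^ 2 + pdx q p * r p / l ^ 2
    - 2 * I * q p * r p / l ^ 4 + 8 * I * (ρ : ℂ) / l ^ 4 - 4 * I / l ^ 6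

/-- Entry `Q₂` of the Lax matrix `Q(λ)` of the coupled system. -/
noncomputable def Qent2 (q r : ℝ × ℝ → ℂ) (ρ : ℝ) (l : ℂ) (p : ℝ × ℝ) : ℂ :=
  -pdx (pdx q) p / l + 3 * I * pdx q p * q p * r p / l + 2 * I * pdx q p / l ^ 3
    + (3 / 2) * (q p) ^ 3 * (r p) ^ 2 / l + 2 * (q p) ^ 2 * r p * (ρ : ℂ) / l
    + 2 * (q p) ^ 2 * r p / l ^ 3 - 4 * q p * (ρ : ℂ) ^ 2 / l
    - 4 * q p * (ρ : ℂ) / l ^ 3 + 4 * q p / l ^ 5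

/-- Entry `Q₃` of the Lax matrix `Q(λ)` of the coupled system. -/
noncomputable def Qent3 (q r : ℝ × ℝ → ℂ) (ρ : ℝ) (l : ℂ) (p : ℝ × ℝ) : ℂ :=
  -pdx (pdx r) p / l - 3 * I * pdx r p * q p * r p / l - 2 * I * pdx r p / l ^ 3
    + (3 / 2) * (q p) ^ 2 * (r p) ^ 3 / l + 2 * q p * (r p) ^ 2 * (ρ : ℂ) / l
    + 2 * q p * (r p) ^ 2 / l ^ 3 - 4 * r p * (ρ : ℂ) ^ 2 / l
    - 4 * r p * (ρ : ℂ) / l ^ 3 + 4 * r p / l ^ 5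

section PartialDerivatives

variable {f : ℝ × ℝ → ℂ}

theorem pdx_eq_fderiv (hf : Differentiable ℝ f) (p : ℝ × ℝ) : pdx f p = fderiv ℝ f p (1, 0) :=
  ((hf p).hasFDerivAt.comp_hasDerivAt p.1
    ((hasDerivAt_id p.1).prodMk (hasDerivAt_const p.1 p.2))).deriv

theorem pdt_eq_fderiv (hf : Differentiable ℝ f) (p : ℝ × ℝ) : pdt f p = fderiv ℝ f p (0, 1) :=
  ((hf p).hasFDerivAt.comp_hasDerivAt p.2
    ((hasDerivAt_const p.2 p.1).prodMk (hasDerivAt_id p.2))).deriv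

theorem hasDerivAt_pdx (hf : Differentiable ℝ f) (p : ℝ × ℝ) :
    HasDerivAt (fun x => f (x, p.2)) (pdx f p) p.1 :=
  ((hf p).hasFDerivAt.comp_hasDerivAt p.1
    ((hasDerivAt_id p.1).prodMk (hasDerivAt_const p.1 p.2))).differentiableAt.hasDerivAt

theorem hasDerivAt_pdt (hf : Differentiable ℝ f) (p : ℝ × ℝ) :
    HasDerivAt (fun t => f (p.1, t)) (pdt f p) p.2 :=
  ((hf p).hasFDerivAt.comp_hasDerivAt p.2
    ((hasDerivAt_const p.2 p.1).prodMk (hasDerivAt_id p.2))).differentiableAt.hasDerivAt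

theorem contDiff_pdx (hf : ContDiff ℝ (⊤ : ℕ∞) f) : ContDiff ℝ (⊤ : ℕ∞) (pdx f) := by
  rw [funext (pdx_eq_fderiv (hf.differentiable (by simp)))]
  exact (hf.fderiv_right (by simp)).clm_apply contDiff_const

theorem contDiff_div_of_ne_zero {g : ℝ × ℝ → ℂ} (hf : ContDiff ℝ (⊤ : ℕ∞) f)
    (hg : ContDiff ℝ (⊤ : ℕ∞) g) (h : ∀ p, g p ≠ 0) :
    ContDiff ℝ (⊤ : ℕ∞) fun p => f p / g p := by
  simp only [div_eq_mul_inv]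
  exact hf.mul (hg.inv h)

theorem pdt_pdx_comm (hf : ContDiff ℝ (⊤ : ℕ∞) f) (p : ℝ × ℝ) :
    pdt (pdx f) p = pdx (pdt f) p := by
  have hd := hf.differentiable (by simp)
  have hd' : Differentiable ℝ (fderiv ℝ f) :=
    (hf.fderiv_right (m := (⊤ : ℕ∞)) (by simp)).differentiable (by simp)
  have key (v : ℝ × ℝ) : HasFDerivAt (fun z => fderiv ℝ f z v)
      ((fderiv ℝ (fderiv ℝ f) p).flip v) p := by
    simpa using (hd' p).hasFDerivAt.clm_apply (hasFDerivAt_const v p)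
  rw [funext (pdx_eq_fderiv hd), funext (pdt_eq_fderiv hd),
    pdt_eq_fderiv fun z => (hd' z).clm_apply (differentiableAt_const _),
    pdx_eq_fderiv fun z => (hd' z).clm_apply (differentiableAt_const _),
    (key _).fderiv, (key _).fderiv]
  exact (hf.contDiffAt.isSymmSndFDerivAt (by simpa using WithTop.coe_le_coe.mpr (le_top (a := (2 : ℕ∞))))).eq (0, 1) (1, 0)

end PartialDerivatives

section LaxPair

/-- Diagonal entry of the time part of the Lax pair, in terms of `μ = λ⁻¹`, the jets of the
potentials and a square root `J` of `-1`. -/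
noncomputable def laxDiag (J ρ q qx r rx μ : ℂ) : ℂ :=
  -4 * J * ρ ^ 2 + (-(3 * J / 2) * q ^ 2 * r ^ 2 - rx * q + qx * r) * μ ^ 2
    + (-2 * J * q * r + 8 * J * ρ) * μ ^ 4 - 4 * J * μ ^ 6

/-- Coefficient of `μ = λ⁻¹` in the upper off-diagonal entry of the time part of the Lax pair. -/
noncomputable def laxOffCoeff (J ρ q qx qxx r : ℂ) : ℂ :=
  -qxx + 3 * J * qx * q * r + 3 / 2 * q ^ 3 * r ^ 2 + 2 * q ^ 2 * r * ρ - 4 * q * ρ ^ 2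

/-- Upper off-diagonal entry of the time part of the Lax pair, in terms of `μ = λ⁻¹`. The lower
one is obtained by exchanging the potentials and replacing `J` by `-J`. -/
noncomputable def laxOff (J ρ q qx qxx r μ : ℂ) : ℂ :=
  laxOffCoeff J ρ q qx qxx r * μ + (2 * J * qx + 2 * q ^ 2 * r - 4 * q * ρ) * μ ^ 3
    + 4 * q * μ ^ 5

/-- `(φ, ψ)` is a smooth solution of the Lax pair at spectral parameter `μ = λ⁻¹`. -/
structure LaxSolution (J ρ μ : ℂ) (q r φ ψ : ℝ × ℝ → ℂ) : Prop where
  smooth_fst : ContDiff ℝ (⊤ : ℕ∞) φ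
  smooth_snd : ContDiff ℝ (⊤ : ℕ∞) ψ
  pdx_fst (p) : pdx φ p = (-J * μ ^ 2 + J * ρ) * φ p + q p * μ * ψ p
  pdx_snd (p) : pdx ψ p = r p * μ * φ p + (J * μ ^ 2 - J * ρ) * ψ p
  pdt_fst (p) : pdt φ p = laxDiag J ρ (q p) (pdx q p) (r p) (pdx r p) μ * φ p
    + laxOff J ρ (q p) (pdx q p) (pdx (pdx q) p) (r p) μ * ψ p
  pdt_snd (p) : pdt ψ p = laxOff (-J) ρ (r p) (pdx r p) (pdx (pdx r) p) (q p) μ * φ p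
    - laxDiag J ρ (q p) (pdx q p) (r p) (pdx r p) μ * ψ p

/-- `(φ, ψ)` is annihilated by the Darboux matrix `!![1 + a μ², b μ; c μ, 1 + d μ²]`. -/
structure DarbouxKernel (μ : ℂ) (a b c d φ ψ : ℝ × ℝ → ℂ) : Prop where
  fst (p) : (1 + a p * μ ^ 2) * φ p + b p * μ * ψ p = 0
  snd (p) : c p * μ * φ p + (1 + d p * μ ^ 2) * ψ p = 0

variable {J ρ μ μ₁ μ₂ : ℂ} {q r φ ψ φ₁ ψ₁ φ₂ ψ₂ a b c d s u : ℝ × ℝ → ℂ}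

theorem LaxSolution.swap (h : LaxSolution J ρ μ q r φ ψ) : LaxSolution (-J) ρ μ r q ψ φ where
  smooth_fst := h.smooth_snd
  smooth_snd := h.smooth_fst
  pdx_fst p := by rw [h.pdx_snd]; ring
  pdx_snd p := by rw [h.pdx_fst]; ring
  pdt_fst p := by rw [h.pdt_snd]; unfold laxDiag; ring
  pdt_snd p := by rw [h.pdt_fst]; unfold laxDiag; rw [neg_neg]; ring

theorem DarbouxKernel.swap (h : DarbouxKernel μ a b c d φ ψ) : DarbouxKernel μ d c b a ψ φ where
  fst p := by linear_combination h.snd p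
  snd p := by linear_combination h.fst p

theorem DarbouxKernel.pdx_eq (h : DarbouxKernel μ a b c d φ ψ) (ha : Differentiable ℝ a)
    (hb : Differentiable ℝ b) (hφ : Differentiable ℝ φ) (hψ : Differentiable ℝ ψ) (p : ℝ × ℝ) :
    pdx a p * μ ^ 2 * φ p + (1 + a p * μ ^ 2) * pdx φ p + pdx b p * μ * ψ p
      + b p * μ * pdx ψ p = 0 := by
  have h₁ := (((((hasDerivAt_pdx ha p).mul_const (μ ^ 2)).const_add 1).fun_mul
    (hasDerivAt_pdx hφ p)).fun_add
      (((hasDerivAt_pdx hb p).mul_const μ).fun_mul (hasDerivAt_pdx hψ p))).unique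
    ((hasDerivAt_const p.1 (0 : ℂ)).congr_of_eventuallyEq (.of_forall fun x => h.fst (x, p.2)))
  linear_combination h₁

theorem DarbouxKernel.pdt_eq (h : DarbouxKernel μ a b c d φ ψ) (ha : Differentiable ℝ a)
    (hb : Differentiable ℝ b) (hφ : Differentiable ℝ φ) (hψ : Differentiable ℝ ψ) (p : ℝ × ℝ) :
    pdt a p * μ ^ 2 * φ p + (1 + a p * μ ^ 2) * pdt φ p + pdt b p * μ * ψ p
      + b p * μ * pdt ψ p = 0 := by
  have h₁ := (((((hasDerivAt_pdt ha p).mul_const (μ ^ 2)).const_add 1).fun_mul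
    (hasDerivAt_pdt hφ p)).fun_add
      (((hasDerivAt_pdt hb p).mul_const μ).fun_mul (hasDerivAt_pdt hψ p))).unique
    ((hasDerivAt_const p.2 (0 : ℂ)).congr_of_eventuallyEq (.of_forall fun t => h.fst (p.1, t)))
  linear_combination h₁

theorem eq_zero_of_two_by_two {x y a b c d : ℂ} (h₁ : x * a + y * b = 0) (h₂ : x * c + y * d = 0)
    (hdet : a * d - c * b ≠ 0) : x = 0 ∧ y = 0 := by
  constructor
  · refine (mul_eq_zero.mp ?_).resolve_right hdet
    linear_combination d * h₁ - b * h₂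
  · refine (mul_eq_zero.mp ?_).resolve_right hdet
    linear_combination a * h₂ - c * h₁

theorem darboux_space (hμ₁ : μ₁ ≠ 0) (hμ₂ : μ₂ ≠ 0)
    (hΦ₁ : LaxSolution J ρ μ₁ q r φ₁ ψ₁) (hΦ₂ : LaxSolution J ρ μ₂ q r φ₂ ψ₂)
    (hT₁ : DarbouxKernel μ₁ a b c d φ₁ ψ₁) (hT₂ : DarbouxKernel μ₂ a b c d φ₂ ψ₂)
    (ha : Differentiable ℝ a) (hb : Differentiable ℝ b)
    (hs : ∀ p, s p = q p - 2 * J * ρ * b p + pdx b p) {p : ℝ × ℝ}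
    (hdet : μ₂ * φ₁ p * ψ₂ p - μ₁ * φ₂ p * ψ₁ p ≠ 0) :
    pdx a p = s p * c p - b p * r p ∧ s p * d p = q p * a p + 2 * J * b p := by
  have key {μ : ℂ} {φ ψ : ℝ × ℝ → ℂ} (hμ : μ ≠ 0) (hΦ : LaxSolution J ρ μ q r φ ψ)
      (hT : DarbouxKernel μ a b c d φ ψ) :
      (pdx a p - (s p * c p - b p * r p)) * φ p
        + (q p * a p + 2 * J * b p - s p * d p) * (μ * ψ p) = 0 := by
    have h := hT.pdx_eq ha hb (hΦ.smooth_fst.differentiable (by simp))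
      (hΦ.smooth_snd.differentiable (by simp)) p
    rw [hΦ.pdx_fst, hΦ.pdx_snd] at h
    refine (mul_eq_zero.mp ?_).resolve_left (pow_ne_zero 2 hμ)
    linear_combination h - (-J * μ ^ 2 + J * ρ) * hT.fst p - s p * μ * hT.snd p
      + μ * ψ p * hs p
  have h := eq_zero_of_two_by_two (key hμ₁ hΦ₁ hT₁) (key hμ₂ hΦ₂ hT₂)
    (fun h => hdet (by linear_combination h))
  exact ⟨by linear_combination h.1, by linear_combination -h.2⟩

theorem darboux_time_intertwine {J ρ q qx qxx r rx rxx a b c d s sx sxx u ux : ℂ}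
    (hJ : J ^ 2 = -1)
    (h : s * d = q * a + 2 * J * b) (h' : u * a = r * d - 2 * J * c)
    (hx : sx * d + s * (u * b - c * q)
      = qx * a + q * (s * c - b * r) + 2 * J * (s - q + 2 * J * ρ * b))
    (hx' : ux * a + u * (s * c - b * r)
      = rx * d + r * (u * b - c * q) - 2 * J * (u - r - 2 * J * ρ * c))
    (hxx : sxx * d + 2 * sx * (u * b - c * q)
        + s * (ux * b + u * (s - q + 2 * J * ρ * b) - (u - r - 2 * J * ρ * c) * q - c * qx)
      = qxx * a + 2 * qx * (s * c - b * r)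
        + q * (sx * c + s * (u - r - 2 * J * ρ * c) - (s - q + 2 * J * ρ * b) * r - b * rx)
        + 2 * J * (sx - qx + 2 * J * ρ * (s - q + 2 * J * ρ * b))) :
    ∃ α, ∀ μ,
      laxDiag J ρ s sx u ux μ * (1 + a * μ ^ 2) + laxOff J ρ s sx sxx u μ * (c * μ)
        - ((1 + a * μ ^ 2) * laxDiag J ρ q qx r rx μ + b * μ * laxOff (-J) ρ r rx rxx q μ)
        = α * μ ^ 2 ∧
      laxDiag J ρ s sx u ux μ * (b * μ) + laxOff J ρ s sx sxx u μ * (1 + d * μ ^ 2)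
        - ((1 + a * μ ^ 2) * laxOff J ρ q qx qxx r μ - b * μ * laxDiag J ρ q qx r rx μ)
        = (-8 * J * ρ ^ 2 * b + laxOffCoeff J ρ s sx sxx u - laxOffCoeff J ρ q qx qxx r) * μ := by
  have e : 4 * s * c - 4 * b * r + a * (-2 * J * (s * u - q * r)) = 0 := by
    linear_combination -2 * J * s * h' - 2 * J * r * h + (4 * s * c - 4 * b * r) * hJ
  have e' : 4 * u * b - 4 * q * c + d * (2 * J * (s * u - q * r)) = 0 := by
    linear_combination 2 * J * u * h + 2 * J * q * h' + (4 * u * b - 4 * q * c) * hJ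
  have e₅ : 4 * s - 4 * q + b * (-2 * J * s * u + 8 * J * ρ - 2 * J * q * r + 8 * J * ρ)
      + (2 * J * sx + 2 * s ^ 2 * u - 4 * s * ρ) * d
      - a * (2 * J * qx + 2 * q ^ 2 * r - 4 * q * ρ) = 0 := by
    grind
  have e₄ : -2 * J * (s * u - q * r) + (2 * J * sx + 2 * s ^ 2 * u - 4 * s * ρ) * c
      - b * (-2 * J * rx + 2 * r ^ 2 * q - 4 * r * ρ)
      + a * (-(3 * J / 2) * s ^ 2 * u ^ 2 - ux * s + sx * u
        + (3 * J / 2) * q ^ 2 * r ^ 2 + rx * q - qx * r) = 0 := by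
    linear_combination -s * hx' - rx * h + sx * h' + r * hx + 3 / 4 * (s * u + q * r) * e
      - (4 * c * ρ * s - 4 * b * r * ρ) * hJ
  have e₃ : (2 * J * sx + 2 * s ^ 2 * u - 4 * s * ρ) - (2 * J * qx + 2 * q ^ 2 * r - 4 * q * ρ)
      + b * (-(3 * J / 2) * s ^ 2 * u ^ 2 - ux * s + sx * u
        - (3 * J / 2) * q ^ 2 * r ^ 2 - rx * q + qx * r)
      + laxOffCoeff J ρ s sx sxx u * d - a * laxOffCoeff J ρ q qx qxx r = 0 := by
    unfold laxOffCoeff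
    linear_combination -hxx + (3 * J * q * r + 3 / 2 * J * (s * u - q * r)) * hx
      + 3 * J * sx * u * h + 3 * J * sx * q * h' - 3 / 4 * sx * e' - 3 / 4 * qx * e
      + (-4 * ρ ^ 2 + 2 * s * u * ρ + 3 / 2 * q ^ 2 * r ^ 2) * h + J * q * ρ * e
      - 3 / 4 * J * s * (s * u + q * r) * e'
      + (6 * sx * (u * b - q * c) - 3 * s * u * q - 4 * s * ρ + 3 * s * q * r + 3 * s ^ 2 * u
        + 4 * ρ * q - 3 * q ^ 2 * r + J * ρ * b * (6 * s * u + 6 * q * r - 8 * ρ)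
        + 2 * ρ * q * a * (s * u - q * r) + 3 / 2 * s * d * (s ^ 2 * u ^ 2 - q ^ 2 * r ^ 2)) * hJ
  refine ⟨(-(3 * J / 2) * s ^ 2 * u ^ 2 - ux * s + sx * u)
    - (-(3 * J / 2) * q ^ 2 * r ^ 2 - rx * q + qx * r)
    + laxOffCoeff J ρ s sx sxx u * c - b * laxOffCoeff (-J) ρ r rx rxx q, fun μ => ⟨?_, ?_⟩⟩
  · unfold laxDiag laxOff
    linear_combination μ ^ 4 * e₄ + μ ^ 6 * e
  · unfold laxDiag laxOff
    linear_combination μ ^ 3 * e₃ + μ ^ 5 * e₅ + 4 * μ ^ 7 * h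

theorem darboux_time (hJ : J ^ 2 = -1) (hμ₁ : μ₁ ≠ 0) (hμ₂ : μ₂ ≠ 0)
    (hΦ₁ : LaxSolution J ρ μ₁ q r φ₁ ψ₁) (hΦ₂ : LaxSolution J ρ μ₂ q r φ₂ ψ₂)
    (hT₁ : DarbouxKernel μ₁ a b c d φ₁ ψ₁) (hT₂ : DarbouxKernel μ₂ a b c d φ₂ ψ₂)
    (hq : ContDiff ℝ (⊤ : ℕ∞) q) (hr : ContDiff ℝ (⊤ : ℕ∞) r)
    (ha : ContDiff ℝ (⊤ : ℕ∞) a) (hb : ContDiff ℝ (⊤ : ℕ∞) b)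
    (hc : ContDiff ℝ (⊤ : ℕ∞) c) (hd : ContDiff ℝ (⊤ : ℕ∞) d)
    (hs : ∀ p, s p = q p - 2 * J * ρ * b p + pdx b p)
    (hu : ∀ p, u p = r p + 2 * J * ρ * c p + pdx c p)
    (hs_smooth : ContDiff ℝ (⊤ : ℕ∞) s) (hu_smooth : ContDiff ℝ (⊤ : ℕ∞) u)
    (hdet : ∀ p, μ₁ * φ₁ p * ψ₂ p - μ₂ * φ₂ p * ψ₁ p ≠ 0)
    (hdet' : ∀ p, μ₂ * φ₁ p * ψ₂ p - μ₁ * φ₂ p * ψ₁ p ≠ 0) (p : ℝ × ℝ) :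
    pdt b p = -8 * J * ρ ^ 2 * b p + laxOffCoeff J ρ (s p) (pdx s p) (pdx (pdx s) p) (u p)
      - laxOffCoeff J ρ (q p) (pdx q p) (pdx (pdx q) p) (r p) := by
  have D {f : ℝ × ℝ → ℂ} (hf : ContDiff ℝ (⊤ : ℕ∞) f) : Differentiable ℝ f :=
    hf.differentiable (by simp)
  have dx {f : ℝ × ℝ → ℂ} (hf : ContDiff ℝ (⊤ : ℕ∞) f) := hasDerivAt_pdx (D hf)
  have E (p) := darboux_space hμ₁ hμ₂ hΦ₁ hΦ₂ hT₁ hT₂ (D ha) (D hb) hs (hdet' p)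
  have F (p) := darboux_space hμ₁ hμ₂ hΦ₁.swap hΦ₂.swap hT₁.swap hT₂.swap (D hd) (D hc) (s := u)
    (fun p => by rw [hu]; ring) (p := p) (fun h => hdet p (by linear_combination -h))
  have hbx (p) : pdx b p = s p - q p + 2 * J * ρ * b p := by linear_combination -hs p
  have hcx (p) : pdx c p = u p - r p - 2 * J * ρ * c p := by linear_combination -hu p
  have hx (p) : pdx s p * d p + s p * pdx d p
      = pdx q p * a p + q p * pdx a p + 2 * J * pdx b p :=
    ((dx hs_smooth p).fun_mul (dx hd p)).unique
      ((((dx hq p).fun_mul (dx ha p)).fun_add ((dx hb p).const_mul (2 * J))).congr_of_eventuallyEq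
        (.of_forall fun x => (E (x, p.2)).2))
  have hx' (p) : pdx u p * a p + u p * pdx a p
      = pdx r p * d p + r p * pdx d p + 2 * -J * pdx c p :=
    ((dx hu_smooth p).fun_mul (dx ha p)).unique
      ((((dx hr p).fun_mul (dx hd p)).fun_add ((dx hc p).const_mul (2 * -J))).congr_of_eventuallyEq
        (.of_forall fun x => (F (x, p.2)).2))
  have haxx : pdx (pdx a) p = _ :=
    (dx (contDiff_pdx ha) p).unique
      ((((dx hs_smooth p).fun_mul (dx hc p)).fun_sub
        ((dx hb p).fun_mul (dx hr p))).congr_of_eventuallyEq (.of_forall fun x => (E (x, p.2)).1))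
  have hdxx : pdx (pdx d) p = _ :=
    (dx (contDiff_pdx hd) p).unique
      ((((dx hu_smooth p).fun_mul (dx hb p)).fun_sub
        ((dx hc p).fun_mul (dx hq p))).congr_of_eventuallyEq (.of_forall fun x => (F (x, p.2)).1))
  have hbxx : pdx (pdx b) p = _ :=
    (dx (contDiff_pdx hb) p).unique
      ((((dx hs_smooth p).fun_sub (dx hq p)).fun_add
        ((dx hb p).const_mul (2 * J * ρ))).congr_of_eventuallyEq
          (.of_forall fun x => hbx (x, p.2)))
  have hxx := (((dx (contDiff_pdx hs_smooth) p).fun_mul (dx hd p)).fun_add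
      ((dx hs_smooth p).fun_mul (dx (contDiff_pdx hd) p))).unique
    (((((dx (contDiff_pdx hq) p).fun_mul (dx ha p)).fun_add
      ((dx hq p).fun_mul (dx (contDiff_pdx ha) p))).fun_add
      ((dx (contDiff_pdx hb) p).const_mul (2 * J))).congr_of_eventuallyEq
        (.of_forall fun x => hx (x, p.2)))
  have hx := hx p
  have hx' := hx' p
  simp only [Prod.mk.eta, haxx, hdxx, hbxx] at hxx
  simp only [(E p).1, (F p).1, hbx p, hcx p] at hx hx' hxx
  obtain ⟨α, hα⟩ := darboux_time_intertwine (qxx := pdx (pdx q) p)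
    (rx := pdx r p) (rxx := pdx (pdx r) p) (sxx := pdx (pdx s) p) (ux := pdx u p) hJ (E p).2
    (by linear_combination (F p).2) hx (by linear_combination hx') (by linear_combination hxx)
  set β := -8 * J * ρ ^ 2 * b p + laxOffCoeff J ρ (s p) (pdx s p) (pdx (pdx s) p) (u p)
      - laxOffCoeff J ρ (q p) (pdx q p) (pdx (pdx q) p) (r p) with hβ
  have key {μ : ℂ} {φ ψ : ℝ × ℝ → ℂ} (hμ : μ ≠ 0) (hΦ : LaxSolution J ρ μ q r φ ψ)
      (hT : DarbouxKernel μ a b c d φ ψ) :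
      (pdt a p - α) * (μ * φ p) + (pdt b p - β) * ψ p = 0 := by
    have h := hT.pdt_eq (D ha) (D hb) (D hΦ.smooth_fst) (D hΦ.smooth_snd) p
    rw [hΦ.pdt_fst, hΦ.pdt_snd] at h
    refine (mul_eq_zero.mp ?_).resolve_left hμ
    linear_combination h + φ p * (hα μ).1 + ψ p * (hα μ).2
      - laxDiag J ρ (s p) (pdx s p) (u p) (pdx u p) μ * hT.fst p
      - laxOff J ρ (s p) (pdx s p) (pdx (pdx s) p) (u p) μ * hT.snd p
  have h := eq_zero_of_two_by_two (key hμ₁ hΦ₁ hT₁) (key hμ₂ hΦ₂ hT₂)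
    (fun h => hdet p (by linear_combination h))
  linear_combination h.2

/-- The first equation of the coupled system, with `J` in place of the imaginary unit. The second
one is obtained by exchanging the potentials and replacing `J` by `-J`. -/
def CoupledEq (J ρ : ℂ) (q r : ℝ × ℝ → ℂ) (p : ℝ × ℝ) : Prop :=
  J * pdt q p + J * pdx (pdx (pdx q)) p + (3 * q p * r p + 2 * ρ) * pdx (pdx q) p
    + 3 * r p * (pdx q p) ^ 2
    + (1 / 2) * (-9 * J * (q p) ^ 2 * (r p) ^ 2 - 20 * J * ρ * q p * r p
        + 8 * J * ρ ^ 2 + 6 * q p * pdx r p) * pdx q p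
    + J * (-3 * (q p) ^ 3 * r p - 2 * ρ * (q p) ^ 2) * pdx r p
    - 3 * ρ * (r p) ^ 2 * (q p) ^ 3 - 4 * ρ ^ 2 * r p * (q p) ^ 2
    + 8 * (ρ ^ 3 - ρ ^ 2) * q p = 0

theorem hasDerivAt_laxOffCoeff (hq : ContDiff ℝ (⊤ : ℕ∞) q) (hr : ContDiff ℝ (⊤ : ℕ∞) r)
    (p : ℝ × ℝ) :
    HasDerivAt (fun x => laxOffCoeff J ρ (q (x, p.2)) (pdx q (x, p.2)) (pdx (pdx q) (x, p.2))
        (r (x, p.2)))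
      (-pdx (pdx (pdx q)) p + 3 * J * (pdx (pdx q) p * q p * r p + pdx q p ^ 2 * r p
          + pdx q p * q p * pdx r p)
        + 3 / 2 * (3 * q p ^ 2 * pdx q p * r p ^ 2 + 2 * q p ^ 3 * r p * pdx r p)
        + 2 * ρ * (2 * q p * pdx q p * r p + q p ^ 2 * pdx r p) - 4 * ρ ^ 2 * pdx q p) p.1 := by
  have dx {f : ℝ × ℝ → ℂ} (hf : ContDiff ℝ (⊤ : ℕ∞) f) :=
    hasDerivAt_pdx (hf.differentiable (by simp)) p
  have h0 := dx hq
  have h1 := dx (contDiff_pdx hq)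
  have h2 := dx (contDiff_pdx (contDiff_pdx hq))
  have hr := dx hr
  unfold laxOffCoeff
  refine HasDerivAt.congr_deriv (((((h2.fun_neg.fun_add (((h1.const_mul (3 * J)).fun_mul h0).fun_mul
    hr)).fun_add (((h0.fun_pow 3).const_mul (3 / 2)).fun_mul (hr.fun_pow 2))).fun_add
    ((((h0.fun_pow 2).const_mul 2).fun_mul hr).mul_const ρ))).fun_sub
    ((h0.const_mul 4).mul_const (ρ ^ 2))) ?_
  push_cast
  ring

theorem coupledEq_darboux (hJ : J ^ 2 = -1) (hμ₁ : μ₁ ≠ 0) (hμ₂ : μ₂ ≠ 0)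
    (hΦ₁ : LaxSolution J ρ μ₁ q r φ₁ ψ₁) (hΦ₂ : LaxSolution J ρ μ₂ q r φ₂ ψ₂)
    (hT₁ : DarbouxKernel μ₁ a b c d φ₁ ψ₁) (hT₂ : DarbouxKernel μ₂ a b c d φ₂ ψ₂)
    (hq : ContDiff ℝ (⊤ : ℕ∞) q) (hr : ContDiff ℝ (⊤ : ℕ∞) r)
    (ha : ContDiff ℝ (⊤ : ℕ∞) a) (hb : ContDiff ℝ (⊤ : ℕ∞) b)
    (hc : ContDiff ℝ (⊤ : ℕ∞) c) (hd : ContDiff ℝ (⊤ : ℕ∞) d)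
    (hs : ∀ p, s p = q p - 2 * J * ρ * b p + pdx b p)
    (hu : ∀ p, u p = r p + 2 * J * ρ * c p + pdx c p)
    (hs_smooth : ContDiff ℝ (⊤ : ℕ∞) s) (hu_smooth : ContDiff ℝ (⊤ : ℕ∞) u)
    (hdet : ∀ p, μ₁ * φ₁ p * ψ₂ p - μ₂ * φ₂ p * ψ₁ p ≠ 0)
    (hdet' : ∀ p, μ₂ * φ₁ p * ψ₂ p - μ₁ * φ₂ p * ψ₁ p ≠ 0)
    (p : ℝ × ℝ) (hqr : CoupledEq J ρ q r p) : CoupledEq J ρ s u p := by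
  have D {f : ℝ × ℝ → ℂ} (hf : ContDiff ℝ (⊤ : ℕ∞) f) : Differentiable ℝ f :=
    hf.differentiable (by simp)
  have hbt := darboux_time hJ hμ₁ hμ₂ hΦ₁ hΦ₂ hT₁ hT₂ hq hr ha hb hc hd hs hu hs_smooth hu_smooth
    hdet hdet'
  have hbtx : pdx (pdt b) p = _ := HasDerivAt.deriv
    (((((hasDerivAt_pdx (D hb) p).const_mul (-8 * J * ρ ^ 2)).fun_add
      (hasDerivAt_laxOffCoeff (J := J) (ρ := ρ) hs_smooth hu_smooth p)).fun_sub
      (hasDerivAt_laxOffCoeff (J := J) (ρ := ρ) hq hr p)).congr_of_eventuallyEq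
        (.of_forall fun x => hbt (x, p.2)))
  have hst : pdt s p = _ := HasDerivAt.deriv
    ((((hasDerivAt_pdt (D hq) p).fun_sub ((hasDerivAt_pdt (D hb) p).const_mul (2 * J * ρ))).fun_add
      (hasDerivAt_pdt (D (contDiff_pdx hb)) p)).congr_of_eventuallyEq
        (.of_forall fun t => hs (p.1, t)))
  rw [pdt_pdx_comm hb, hbtx, hbt p] at hst
  let G (f g : ℝ × ℝ → ℂ) : ℂ :=
    3 * (pdx (pdx f) p * f p * g p + pdx f p ^ 2 * g p + pdx f p * f p * pdx g p)
      - 2 * ρ * laxOffCoeff J ρ (f p) (pdx f p) (pdx (pdx f) p) (g p) - 8 * ρ ^ 2 * f p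
  unfold CoupledEq at hqr ⊢
  linear_combination (norm := skip) hqr + J * hst + 8 * J ^ 2 * ρ ^ 2 * hs p
    + (G s u - G q r) * hJ
  simp only [G]
  unfold laxOffCoeff
  ring

end LaxPair

theorem LaxSolution.of_inv {q r φ ψ : ℝ × ℝ → ℂ} {ρ : ℝ} {l : ℂ}
    (hφ : ContDiff ℝ (⊤ : ℕ∞) φ) (hψ : ContDiff ℝ (⊤ : ℕ∞) ψ)
    (hx : ∀ p : ℝ × ℝ,
      pdx φ p = (-I / l ^ 2 + (ρ : ℂ) * I) * φ p + q p / l * ψ p ∧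
      pdx ψ p = r p / l * φ p + (I / l ^ 2 - (ρ : ℂ) * I) * ψ p)
    (ht : ∀ p : ℝ × ℝ,
      pdt φ p = Qent1 q r ρ l p * φ p + Qent2 q r ρ l p * ψ p ∧
      pdt ψ p = Qent3 q r ρ l p * φ p - Qent1 q r ρ l p * ψ p) :
    LaxSolution I ρ l⁻¹ q r φ ψ where
  smooth_fst := hφ
  smooth_snd := hψ
  pdx_fst p := by rw [(hx p).1]; ring
  pdx_snd p := by rw [(hx p).2]; ring
  pdt_fst p := by
    rw [(ht p).1]; unfold Qent1 Qent2 laxDiag laxOff laxOffCoeff; ring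
  pdt_snd p := by
    rw [(ht p).2]; unfold Qent1 Qent3 laxDiag laxOff laxOffCoeff; ring

theorem coupledS_iff {q r : ℝ × ℝ → ℂ} {ρ : ℝ} :
    CoupledS q r ρ ↔ ∀ p, CoupledEq I ρ q r p ∧ CoupledEq (-I) ρ r q p := by
  refine forall_congr' fun p => and_congr Iff.rfl ?_
  unfold CoupledEq
  rw [← neg_eq_zero]
  refine Eq.congr ?_ rfl
  ring

/-- the one-fold Darboux transformation maps a smooth solution of the
coupled system (S) to another smooth solution of (S). -/
theorem onefold_darboux_transformation
    (ρ : ℝ) (q r : ℝ × ℝ → ℂ)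
    (hq : ContDiff ℝ (⊤ : ℕ∞) q) (hr : ContDiff ℝ (⊤ : ℕ∞) r) (hqr : CoupledS q r ρ)
    (l1 l2 : ℂ) (hl1 : l1 ≠ 0) (hl2 : l2 ≠ 0)
    (φ11 φ21 φ12 φ22 : ℝ × ℝ → ℂ)
    (hsm11 : ContDiff ℝ (⊤ : ℕ∞) φ11) (hsm21 : ContDiff ℝ (⊤ : ℕ∞) φ21)
    (hsm12 : ContDiff ℝ (⊤ : ℕ∞) φ12) (hsm22 : ContDiff ℝ (⊤ : ℕ∞) φ22)
    (hlaxx1 : ∀ p : ℝ × ℝ,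
      pdx φ11 p = (-I / l1 ^ 2 + (ρ : ℂ) * I) * φ11 p + q p / l1 * φ21 p ∧
      pdx φ21 p = r p / l1 * φ11 p + (I / l1 ^ 2 - (ρ : ℂ) * I) * φ21 p)
    (hlaxx2 : ∀ p : ℝ × ℝ,
      pdx φ12 p = (-I / l2 ^ 2 + (ρ : ℂ) * I) * φ12 p + q p / l2 * φ22 p ∧
      pdx φ22 p = r p / l2 * φ12 p + (I / l2 ^ 2 - (ρ : ℂ) * I) * φ22 p)
    (hlaxt1 : ∀ p : ℝ × ℝ,
      pdt φ11 p = Qent1 q r ρ l1 p * φ11 p + Qent2 q r ρ l1 p * φ21 p ∧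
      pdt φ21 p = Qent3 q r ρ l1 p * φ11 p - Qent1 q r ρ l1 p * φ21 p)
    (hlaxt2 : ∀ p : ℝ × ℝ,
      pdt φ12 p = Qent1 q r ρ l2 p * φ12 p + Qent2 q r ρ l2 p * φ22 p ∧
      pdt φ22 p = Qent3 q r ρ l2 p * φ12 p - Qent1 q r ρ l2 p * φ22 p)
    (hden1 : ∀ p : ℝ × ℝ, l2 * φ11 p * φ22 p - l1 * φ12 p * φ21 p ≠ 0)
    (hden2 : ∀ p : ℝ × ℝ, l1 * φ11 p * φ22 p - l2 * φ12 p * φ21 p ≠ 0)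
    (A2 A3 : ℝ × ℝ → ℂ)
    (hA2 : ∀ p : ℝ × ℝ, A2 p = (l1 ^ 2 - l2 ^ 2) * φ11 p * φ12 p
      / (l2 * φ11 p * φ22 p - l1 * φ12 p * φ21 p))
    (hA3 : ∀ p : ℝ × ℝ, A3 p = (l2 ^ 2 - l1 ^ 2) * φ21 p * φ22 p
      / (l1 * φ11 p * φ22 p - l2 * φ12 p * φ21 p)) :
    ContDiff ℝ (⊤ : ℕ∞) (fun p : ℝ × ℝ => q p - 2 * I * (ρ : ℂ) * A2 p + pdx A2 p) ∧
    ContDiff ℝ (⊤ : ℕ∞) (fun p : ℝ × ℝ => r p + 2 * I * (ρ : ℂ) * A3 p + pdx A3 p) ∧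
    CoupledS (fun p => q p - 2 * I * (ρ : ℂ) * A2 p + pdx A2 p)
      (fun p => r p + 2 * I * (ρ : ℂ) * A3 p + pdx A3 p) ρ := by
  obtain ⟨Δ₁, hΔ₁⟩ : ∃ f : ℝ × ℝ → ℂ, ∀ p, f p = l2 * φ11 p * φ22 p - l1 * φ12 p * φ21 p :=
    ⟨_, fun _ => rfl⟩
  obtain ⟨Δ₂, hΔ₂⟩ : ∃ f : ℝ × ℝ → ℂ, ∀ p, f p = l1 * φ11 p * φ22 p - l2 * φ12 p * φ21 p :=
    ⟨_, fun _ => rfl⟩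
  have hΔ₁_smooth : ContDiff ℝ (⊤ : ℕ∞) Δ₁ := by
    rw [funext hΔ₁]
    fun_prop
  have hΔ₂_smooth : ContDiff ℝ (⊤ : ℕ∞) Δ₂ := by
    rw [funext hΔ₂]
    fun_prop
  simp only [← hΔ₁] at hden1 hA2
  simp only [← hΔ₂] at hden2 hA3
  have hb : ContDiff ℝ (⊤ : ℕ∞) A2 := by
    rw [funext hA2]
    exact contDiff_div_of_ne_zero (by fun_prop) hΔ₁_smooth hden1
  have hc : ContDiff ℝ (⊤ : ℕ∞) A3 := by
    rw [funext hA3]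
    exact contDiff_div_of_ne_zero (by fun_prop) hΔ₂_smooth hden2
  have ha : ContDiff ℝ (⊤ : ℕ∞) fun p => -(l1 * l2) * Δ₂ p / Δ₁ p :=
    contDiff_div_of_ne_zero (by fun_prop) hΔ₁_smooth hden1
  have hd : ContDiff ℝ (⊤ : ℕ∞) fun p => -(l1 * l2) * Δ₁ p / Δ₂ p :=
    contDiff_div_of_ne_zero (by fun_prop) hΔ₂_smooth hden2
  have hΦ₁ := LaxSolution.of_inv hsm11 hsm21 hlaxx1 hlaxt1
  have hΦ₂ := LaxSolution.of_inv hsm12 hsm22 hlaxx2 hlaxt2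
  have hT₁ : DarbouxKernel l1⁻¹ (fun p => -(l1 * l2) * Δ₂ p / Δ₁ p) A2 A3
      (fun p => -(l1 * l2) * Δ₁ p / Δ₂ p) φ11 φ21 := by
    constructor <;> intro p <;> have h₁ := hden1 p <;> have h₂ := hden2 p <;>
      simp only [hA2, hA3] <;> field_simp <;> simp only [hΔ₁, hΔ₂] <;> ring
  have hT₂ : DarbouxKernel l2⁻¹ (fun p => -(l1 * l2) * Δ₂ p / Δ₁ p) A2 A3
      (fun p => -(l1 * l2) * Δ₁ p / Δ₂ p) φ12 φ22 := by
    constructor <;> intro p <;> have h₁ := hden1 p <;> have h₂ := hden2 p <;>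
      simp only [hA2, hA3] <;> field_simp <;> simp only [hΔ₁, hΔ₂] <;> ring
  have hdet (p : ℝ × ℝ) : l1⁻¹ * φ11 p * φ22 p - l2⁻¹ * φ12 p * φ21 p ≠ 0 := by
    have h : l1⁻¹ * φ11 p * φ22 p - l2⁻¹ * φ12 p * φ21 p = (l1 * l2)⁻¹ * Δ₁ p := by
      simp only [hΔ₁]
      field_simp
    rw [h]
    exact mul_ne_zero (inv_ne_zero (mul_ne_zero hl1 hl2)) (hden1 p)
  have hdet' (p : ℝ × ℝ) : l2⁻¹ * φ11 p * φ22 p - l1⁻¹ * φ12 p * φ21 p ≠ 0 := by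
    have h : l2⁻¹ * φ11 p * φ22 p - l1⁻¹ * φ12 p * φ21 p = (l1 * l2)⁻¹ * Δ₂ p := by
      simp only [hΔ₂]
      field_simp
    rw [h]
    exact mul_ne_zero (inv_ne_zero (mul_ne_zero hl1 hl2)) (hden2 p)
  have hbx := contDiff_pdx hb
  have hcx := contDiff_pdx hc
  have hs : ContDiff ℝ (⊤ : ℕ∞) fun p => q p - 2 * I * (ρ : ℂ) * A2 p + pdx A2 p := by fun_prop
  have hu : ContDiff ℝ (⊤ : ℕ∞) fun p => r p + 2 * I * (ρ : ℂ) * A3 p + pdx A3 p := by fun_prop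
  refine ⟨hs, hu, coupledS_iff.mpr fun p => ⟨?_, ?_⟩⟩
  · exact coupledEq_darboux I_sq (inv_ne_zero hl1) (inv_ne_zero hl2) hΦ₁ hΦ₂ hT₁ hT₂ hq hr
      ha hb hc hd (fun _ => rfl) (fun _ => rfl) hs hu hdet hdet' p (coupledS_iff.mp hqr p).1
  · exact coupledEq_darboux (by simp) (inv_ne_zero hl1) (inv_ne_zero hl2) hΦ₁.swap hΦ₂.swap
      hT₁.swap hT₂.swap hr hq hd hc hb ha (fun _ => by ring) (fun _ => by ring) hu hs
      (fun p h => hdet' p (by linear_combination -h)) (fun p h => hdet p (by linear_combination -h))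
      p (coupledS_iff.mp hqr p).2
end

section
/- (Fundamental line rogue wave.) Define d(x,t) := −3t + 2x + 2 + 3it − 2ix and q_l(x,t) := [ 18i t² + (−24i x − 12 − 12i) t + 8i x² + 8(1+i) x + 4 − 8i ] e^{(i/2)(t − 2x)} / d(x,t)². Then d(x,t) ≠ 0 for every (x,t) ∈ ℝ², q_l is smooth on ℝ², and q_l satisfies the nonlocal equation (E) with parameter ρ = 0 at every (x,t) ∈ ℝ². -/
open Complex

/-- The reverse space-time reflection `q̃(x,t) = q(-x,-t)`. -/
def tq (q : ℝ × ℝ → ℂ) : ℝ × ℝ → ℂ := fun p => q (-p.1, -p.2)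

/-- `q̂₁(x,t) = (∂ₓq)(-x,-t)`. -/
noncomputable def hq1 (q : ℝ × ℝ → ℂ) : ℝ × ℝ → ℂ := fun p => pdx q (-p.1, -p.2)

/-- `q̂₂(x,t) = (∂ₓ²q)(-x,-t)`. -/
noncomputable def hq2 (q : ℝ × ℝ → ℂ) : ℝ × ℝ → ℂ := fun p => pdx (pdx q) (-p.1, -p.2)

/-- The reverse space-time nonlocal equation (E) at a single point. -/
noncomputable def NonlocalEAt (q : ℝ × ℝ → ℂ) (ρ : ℝ) (p : ℝ × ℝ) : Prop :=
  I * pdt q p + I * pdx (pdx (pdx q)) p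
    - 3 * pdx (fun p' => q p' * tq q p' * pdx q p' + (I / 2) * (q p') ^ 3 * (tq q p') ^ 2) p
    + (ρ : ℂ) * (2 * pdx (pdx q) p - 3 * (q p) ^ 3 * (tq q p) ^ 2)
    + (ρ : ℂ) * (-2 * I * (q p) ^ 2 * hq1 q p + 10 * I * q p * tq q p * pdx q p)
    + (ρ : ℂ) ^ 2 * (4 * (q p) ^ 2 * tq q p + 4 * I * pdx q p - 8 * q p)
    + 8 * (ρ : ℂ) ^ 3 * q p = 0

/-- The reverse space-time nonlocal equation (E). -/
noncomputable def NonlocalE (q : ℝ × ℝ → ℂ) (ρ : ℝ) : Prop :=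
  ∀ p : ℝ × ℝ, NonlocalEAt q ρ p

/-- The denominator of the fundamental line rogue wave. -/
noncomputable def dLine : ℝ × ℝ → ℂ := fun p =>
  (-3 * (p.2 : ℂ) + 2 * (p.1 : ℂ) + 2) + I * (3 * (p.2 : ℂ) - 2 * (p.1 : ℂ))

/-- The fundamental line rogue wave (W-shaped rational soliton). -/
noncomputable def qLine : ℝ × ℝ → ℂ := fun p =>
  (18 * I * (p.2 : ℂ) ^ 2 + (-24 * I * (p.1 : ℂ) - 12 - 12 * I) * (p.2 : ℂ)
      + 8 * I * (p.1 : ℂ) ^ 2 + 8 * (1 + I) * (p.1 : ℂ) + 4 - 8 * I)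
    * Complex.exp ((I / 2) * ((p.2 : ℂ) - 2 * (p.1 : ℂ))) / (dLine p) ^ 2

/-- The plane-wave carrier of the line rogue wave. -/
noncomputable def carrier : ℝ × ℝ → ℂ := fun p =>
  Complex.exp ((I / 2) * ((p.2 : ℂ) - 2 * (p.1 : ℂ)))

theorem dLine_ne_zero (p : ℝ × ℝ) : dLine p ≠ 0 := by
  intro h
  have hre := congrArg Complex.re h
  have him := congrArg Complex.im h
  simp [dLine] at hre him
  linarith

theorem dLine_neg (p : ℝ × ℝ) : dLine (-p.1, -p.2) = 4 - dLine p := by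
  simp only [dLine, ofReal_neg]
  ring

theorem carrier_neg (p : ℝ × ℝ) : carrier (-p.1, -p.2) = (carrier p)⁻¹ := by
  rw [carrier, carrier, ← Complex.exp_neg]
  congr 1
  push_cast
  ring

theorem qLine_eq_carrier_mul : qLine = fun p =>
    (-1 + 4 * (1 + I) * (dLine p)⁻¹ - 16 * I * (dLine p)⁻¹ ^ 2) * carrier p := by
  funext p
  have hd := dLine_ne_zero p
  have key : 18 * I * (p.2 : ℂ) ^ 2 + (-24 * I * (p.1 : ℂ) - 12 - 12 * I) * (p.2 : ℂ)
      + 8 * I * (p.1 : ℂ) ^ 2 + 8 * (1 + I) * (p.1 : ℂ) + 4 - 8 * I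
      = -(dLine p) ^ 2 + 4 * (1 + I) * dLine p - 16 * I := by
    simp only [dLine]
    linear_combination ((3 * (p.2 : ℂ) - 2 * p.1) ^ 2 - 4 * (3 * (p.2 : ℂ) - 2 * p.1)) * I_sq
  rw [qLine, key, carrier]
  field_simp

theorem tq_qLine : tq qLine = fun p =>
    (-1 + 4 * (1 + I) * (4 - dLine p)⁻¹ - 16 * I * (4 - dLine p)⁻¹ ^ 2) * (carrier p)⁻¹ := by
  funext p
  simp only [tq, qLine_eq_carrier_mul, dLine_neg, carrier_neg]

theorem contDiff_qLine : ContDiff ℝ (⊤ : ℕ∞) qLine := by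
  have hx : ContDiff ℝ (⊤ : ℕ∞) (fun p : ℝ × ℝ => (p.1 : ℂ)) :=
    Complex.ofRealCLM.contDiff.comp contDiff_fst
  have ht : ContDiff ℝ (⊤ : ℕ∞) (fun p : ℝ × ℝ => (p.2 : ℂ)) :=
    Complex.ofRealCLM.contDiff.comp contDiff_snd
  have hd : ContDiff ℝ (⊤ : ℕ∞) dLine := by
    unfold dLine
    fun_prop
  unfold qLine
  simp only [div_eq_mul_inv _ (dLine _ ^ 2)]
  exact ContDiff.mul (by fun_prop) ((hd.pow 2).inv fun p => pow_ne_zero 2 (dLine_ne_zero p))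

theorem hasDerivAt_dLine_fst (x t : ℝ) :
    HasDerivAt (fun x : ℝ => dLine (x, t)) (2 * (1 - I)) x := by
  have hx : HasDerivAt (fun x : ℝ => (x : ℂ)) 1 x := Complex.ofRealCLM.hasDerivAt
  have h := (hx.const_mul (2 * (1 - I))).add_const (-3 * (t : ℂ) + 2 + I * (3 * t))
  simp only [mul_one] at h
  refine h.congr_of_eventuallyEq (.of_forall fun y => ?_)
  simp only [dLine]
  ring

theorem hasDerivAt_dLine_snd (x t : ℝ) :
    HasDerivAt (fun t : ℝ => dLine (x, t)) (-3 * (1 - I)) t := by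
  have ht : HasDerivAt (fun t : ℝ => (t : ℂ)) 1 t := Complex.ofRealCLM.hasDerivAt
  have h := (ht.const_mul (-3 * (1 - I))).add_const (2 * (x : ℂ) + 2 - I * (2 * x))
  simp only [mul_one] at h
  refine h.congr_of_eventuallyEq (.of_forall fun y => ?_)
  simp only [dLine]
  ring

theorem hasDerivAt_carrier_fst (x t : ℝ) :
    HasDerivAt (fun x : ℝ => carrier (x, t)) (-I * carrier (x, t)) x := by
  have hx : HasDerivAt (fun x : ℝ => (x : ℂ)) 1 x := Complex.ofRealCLM.hasDerivAt
  refine ((((hx.const_mul 2).const_sub (t : ℂ)).const_mul (I / 2)).cexp).congr_deriv ?_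
  simp only [carrier]
  ring

theorem hasDerivAt_carrier_snd (x t : ℝ) :
    HasDerivAt (fun t : ℝ => carrier (x, t)) (I / 2 * carrier (x, t)) t := by
  have ht : HasDerivAt (fun t : ℝ => (t : ℂ)) 1 t := Complex.ofRealCLM.hasDerivAt
  refine (((ht.sub_const (2 * (x : ℂ))).const_mul (I / 2)).cexp).congr_deriv ?_
  simp only [carrier]
  ring

/-- The `x`-derivative of a polynomial in `(dLine p)⁻¹` times the carrier. -/
theorem hasDerivAt_eval_inv_dLine_mul_carrier_fst (P : Polynomial ℂ) (x t : ℝ) :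
    HasDerivAt (fun x : ℝ => P.eval (dLine (x, t))⁻¹ * carrier (x, t))
      ((-(2 * (1 - I)) * (dLine (x, t))⁻¹ ^ 2 * P.derivative.eval (dLine (x, t))⁻¹
        - I * P.eval (dLine (x, t))⁻¹) * carrier (x, t)) x := by
  have hw := (hasDerivAt_dLine_fst x t).fun_inv (dLine_ne_zero (x, t))
  refine (((P.hasDerivAt _).comp x hw).mul (hasDerivAt_carrier_fst x t)).congr_deriv ?_
  simp only [Function.comp_apply]
  ring

theorem hasDerivAt_eval_inv_dLine_mul_carrier_snd (P : Polynomial ℂ) (x t : ℝ) :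
    HasDerivAt (fun t : ℝ => P.eval (dLine (x, t))⁻¹ * carrier (x, t))
      ((3 * (1 - I) * (dLine (x, t))⁻¹ ^ 2 * P.derivative.eval (dLine (x, t))⁻¹
        + I / 2 * P.eval (dLine (x, t))⁻¹) * carrier (x, t)) t := by
  have hw := (hasDerivAt_dLine_snd x t).fun_inv (dLine_ne_zero (x, t))
  refine (((P.hasDerivAt _).comp t hw).mul (hasDerivAt_carrier_snd x t)).congr_deriv ?_
  simp only [Function.comp_apply]
  ring

/-- The action of `∂ₓ` on the polynomial factor of `P((dLine p)⁻¹) * carrier p`. -/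
noncomputable def carrierDeriv (P : Polynomial ℂ) : Polynomial ℂ :=
  Polynomial.C (-(2 * (1 - I))) * Polynomial.X ^ 2 * P.derivative - Polynomial.C I * P

theorem hasDerivAt_carrierDeriv (P : Polynomial ℂ) (x t : ℝ) :
    HasDerivAt (fun x : ℝ => P.eval (dLine (x, t))⁻¹ * carrier (x, t))
      ((carrierDeriv P).eval (dLine (x, t))⁻¹ * carrier (x, t)) x := by
  simpa [carrierDeriv] using hasDerivAt_eval_inv_dLine_mul_carrier_fst P x t

theorem pdx_eval_inv_dLine_mul_carrier (P : Polynomial ℂ) :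
    pdx (fun p => P.eval (dLine p)⁻¹ * carrier p) =
      fun p => (carrierDeriv P).eval (dLine p)⁻¹ * carrier p :=
  funext fun p => (hasDerivAt_carrierDeriv P p.1 p.2).deriv

/-- The polynomial factor of the line rogue wave. -/
noncomputable def linePoly : Polynomial ℂ :=
  -1 + Polynomial.C (4 * (1 + I)) * Polynomial.X - Polynomial.C (16 * I) * Polynomial.X ^ 2

theorem qLine_eq_linePoly : qLine = fun p => linePoly.eval (dLine p)⁻¹ * carrier p := by
  rw [qLine_eq_carrier_mul]
  simp [linePoly]

theorem hasDerivAt_tq_qLine (x t : ℝ) :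
    HasDerivAt (fun x : ℝ => tq qLine (x, t)) (-pdx qLine (-x, -t)) x := by
  have h := hasDerivAt_carrierDeriv linePoly (-x) (-t)
  have h2 := h.scomp x (hasDerivAt_neg x)
  rw [qLine_eq_linePoly, pdx_eval_inv_dLine_mul_carrier]
  simpa [tq, Function.comp_def] using h2

theorem nonlocalE_qLine : NonlocalE qLine 0 := by
  rintro ⟨x, t⟩
  have hpdx : pdx qLine = fun p => (carrierDeriv linePoly).eval (dLine p)⁻¹ * carrier p := by
    rw [qLine_eq_linePoly]; exact pdx_eval_inv_dLine_mul_carrier linePoly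
  have hq : HasDerivAt (fun x : ℝ => qLine (x, t)) (pdx qLine (x, t)) x := by
    rw [hpdx, qLine_eq_linePoly]
    exact hasDerivAt_carrierDeriv linePoly x t
  have hqx : HasDerivAt (fun x : ℝ => pdx qLine (x, t)) (pdx (pdx qLine) (x, t)) x := by
    rw [hpdx, pdx_eval_inv_dLine_mul_carrier]
    exact hasDerivAt_carrierDeriv (carrierDeriv linePoly) x t
  have hqt : pdt (fun p => linePoly.eval (dLine p)⁻¹ * carrier p) (x, t) = _ :=
    (hasDerivAt_eval_inv_dLine_mul_carrier_snd linePoly x t).deriv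
  rw [← qLine_eq_linePoly] at hqt
  have hT := hasDerivAt_tq_qLine x t
  have hflux : pdx (fun p' => qLine p' * tq qLine p' * pdx qLine p'
      + (I / 2) * (qLine p') ^ 3 * (tq qLine p') ^ 2) (x, t) = _ :=
    (((hq.mul hT).mul hqx).add (((hq.pow 3).const_mul (I / 2)).mul (hT.pow 2))).deriv
  have hd := dLine_ne_zero (x, t)
  have hh : 4 - dLine (x, t) ≠ 0 := dLine_neg (x, t) ▸ dLine_ne_zero (-x, -t)
  have hE : carrier (x, t) ≠ 0 := Complex.exp_ne_zero _
  have hdn := dLine_neg (x, t)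
  have hcn := carrier_neg (x, t)
  simp only at hdn hcn
  unfold NonlocalEAt
  rw [hflux, hqt, hpdx]
  simp only [pdx_eval_inv_dLine_mul_carrier, tq_qLine]
  simp only [qLine_eq_linePoly, hdn, hcn, ofReal_zero]
  simp [carrierDeriv, linePoly, -inv_pow]
  generalize dLine (x, t) = d at *
  generalize carrier (x, t) = E at *
  field_simp
  ring_nf
  have hI3 : I ^ 3 = -I := by rw [pow_succ, I_sq]; ring
  have hI5 : I ^ 5 = I := by rw [pow_succ, I_pow_four]; ring
  have hI6 : I ^ 6 = -1 := by rw [pow_succ, hI5]; simp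
  have hI7 : I ^ 7 = -I := by rw [pow_succ, hI6]; ring
  simp only [I_sq, hI3, I_pow_four, hI5, hI6, hI7]
  ring

/-- the fundamental line rogue wave has a nowhere-vanishing
denominator, is smooth, and solves the nonlocal equation (E) with `ρ = 0`. -/
theorem line_rogue_wave_solves_nonlocal_equation :
    (∀ p : ℝ × ℝ, dLine p ≠ 0) ∧ ContDiff ℝ (⊤ : ℕ∞) qLine ∧ NonlocalE qLine 0 := by
  exact ⟨dLine_ne_zero, contDiff_qLine, nonlocalE_qLine⟩
end

section
/- (First-order rogue wave.) Define D(x,t) := 390i√7 t + 4i√7 x + √7 + 11i − 770 t + 84 x and Q(x,t) := 300300i√7 t² − 29680i√7 t x − 336i√7 x² + 125i√7 + 5740√7 t − 952√7 x − 35420i t + 280i x + 235900 t² + 75600 t x − 3472 x² + 97, and set q_r(x,t) := 2 e^{2i(9t − x)} Q(x,t) / D(x,t)². Then q_r satisfies the nonlocal equation (E) with parameter ρ = 1 at every point (x,t) ∈ ℝ² such that D(x,t) ≠ 0 and D(−x,−t) ≠ 0. -/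
open Complex

/-- The denominator of the first-order rogue wave. -/
noncomputable def Drw : ℝ × ℝ → ℂ := fun p =>
  390 * I * (Real.sqrt 7 : ℂ) * (p.2 : ℂ) + 4 * I * (Real.sqrt 7 : ℂ) * (p.1 : ℂ)
    + (Real.sqrt 7 : ℂ) + 11 * I - 770 * (p.2 : ℂ) + 84 * (p.1 : ℂ)

/-- The numerator polynomial of the first-order rogue wave. -/
noncomputable def Qrw : ℝ × ℝ → ℂ := fun p =>
  300300 * I * (Real.sqrt 7 : ℂ) * (p.2 : ℂ) ^ 2
    - 29680 * I * (Real.sqrt 7 : ℂ) * (p.2 : ℂ) * (p.1 : ℂ)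
    - 336 * I * (Real.sqrt 7 : ℂ) * (p.1 : ℂ) ^ 2
    + 125 * I * (Real.sqrt 7 : ℂ)
    + 5740 * (Real.sqrt 7 : ℂ) * (p.2 : ℂ) - 952 * (Real.sqrt 7 : ℂ) * (p.1 : ℂ)
    - 35420 * I * (p.2 : ℂ) + 280 * I * (p.1 : ℂ)
    + 235900 * (p.2 : ℂ) ^ 2 + 75600 * (p.2 : ℂ) * (p.1 : ℂ) - 3472 * (p.1 : ℂ) ^ 2 + 97

/-- The first-order rogue wave. -/
noncomputable def qRogue : ℝ × ℝ → ℂ := fun p =>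
  2 * Complex.exp (2 * I * (9 * (p.2 : ℂ) - (p.1 : ℂ))) * Qrw p / (Drw p) ^ 2

open Polynomial

/-- The phase factor `e^{2i(9t-x)}` of the rogue wave. -/
noncomputable def rwPhase (p : ℝ × ℝ) : ℂ := exp (2 * I * (9 * (p.2 : ℂ) - (p.1 : ℂ)))

/-- The Möbius variable `m = -D(-x,-t) / D(x,t)`. -/
noncomputable def rwVar (p : ℝ × ℝ) : ℂ := -Drw (-p.1, -p.2) / Drw p

/-- The square root `i√7` of `-7`. -/
noncomputable def rwRoot : ℂ := I * (Real.sqrt 7 : ℂ)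

/-- The function `e^{2i(9t-x)} P(m)` attached to a polynomial `P`. -/
noncomputable def rwFun (P : ℂ[X]) (p : ℝ × ℝ) : ℂ := rwPhase p * P.eval (rwVar p)

/-- The operator on polynomials induced by `i ∂ₓ` through `rwFun`. -/
noncomputable def rwDx (P : ℂ[X]) : ℂ[X] :=
  2 * P + C ((rwRoot + 7) / 2) * (1 - X) ^ 2 * derivative P

/-- The operator on polynomials induced by `i ∂ₜ` through `rwFun`. -/
noncomputable def rwDt (P : ℂ[X]) : ℂ[X] :=
  -18 * P + C ((55 * rwRoot - 175) / 4) * (1 - X) ^ 2 * derivative P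

/-- The polynomial representing the first-order rogue wave. -/
noncomputable def rwPoly : ℂ[X] := -X * (C (1 - rwRoot) + C rwRoot * X)

lemma sq_sqrt_seven : (Real.sqrt 7 : ℂ) ^ 2 = 7 := by
  rw [← ofReal_pow, Real.sq_sqrt (by norm_num)]; norm_num

lemma rwRoot_sq : rwRoot ^ 2 = -7 := by
  rw [rwRoot, mul_pow, I_sq, sq_sqrt_seven]; ring

lemma rwPhase_ne_zero (p : ℝ × ℝ) : rwPhase p ≠ 0 := exp_ne_zero _

lemma rwPhase_neg (p : ℝ × ℝ) : rwPhase (-p.1, -p.2) = (rwPhase p)⁻¹ := by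
  rw [rwPhase, rwPhase, ← exp_neg]; congr 1; push_cast; ring

lemma rwVar_neg (p : ℝ × ℝ) : rwVar (-p.1, -p.2) = (rwVar p)⁻¹ := by
  simp [rwVar, neg_div]

lemma two_mul_Qrw (p : ℝ × ℝ) :
    2 * Qrw p = Drw (-p.1, -p.2) *
      ((1 - rwRoot) * Drw p - rwRoot * Drw (-p.1, -p.2)) := by
  have hs := sq_sqrt_seven
  have hI := I_sq
  simp only [Qrw, Drw, rwRoot]
  push_cast
  generalize (Real.sqrt 7 : ℂ) = s at *
  generalize (p.1 : ℂ) = x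
  generalize (p.2 : ℂ) = t
  generalize I = i at *
  grind

lemma qRogue_eq : qRogue = rwFun rwPoly := by
  funext p
  by_cases hD : Drw p = 0
  · simp [qRogue, rwFun, rwPoly, rwVar, hD]
  · have h := two_mul_Qrw p
    have : qRogue p = rwPhase p * (2 * Qrw p) / Drw p ^ 2 := by
      simp only [qRogue, rwPhase]; ring
    rw [this, h]
    simp only [rwFun, rwPoly, rwVar, eval_mul, eval_neg, eval_X, eval_add, eval_C]
    field_simp
    ring

lemma hasDerivAt_Drw_x (x t : ℝ) :
    HasDerivAt (fun y : ℝ => Drw (y, t)) (4 * I * (Real.sqrt 7 : ℂ) + 84) x := by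
  have h := (hasDerivAt_id x).ofReal_comp
  exact ((((((h.const_mul (4 * I * (Real.sqrt 7 : ℂ))).const_add
    (390 * I * (Real.sqrt 7 : ℂ) * (t : ℂ))).add_const (Real.sqrt 7 : ℂ)).add_const
    (11 * I)).sub_const (770 * (t : ℂ))).add (h.const_mul 84)).congr_deriv (by simp)

lemma hasDerivAt_Drw_t (x t : ℝ) :
    HasDerivAt (fun y : ℝ => Drw (x, y)) (390 * I * (Real.sqrt 7 : ℂ) - 770) t := by
  have h := (hasDerivAt_id t).ofReal_comp
  exact ((((((h.const_mul (390 * I * (Real.sqrt 7 : ℂ))).add_const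
    (4 * I * (Real.sqrt 7 : ℂ) * (x : ℂ))).add_const (Real.sqrt 7 : ℂ)).add_const
    (11 * I)).sub (h.const_mul 770)).add_const (84 * (x : ℂ))).congr_deriv (by simp)

lemma Drw_neg (p : ℝ × ℝ) :
    Drw (-p.1, -p.2) = 2 * ((Real.sqrt 7 : ℂ) + 11 * I) - Drw p := by
  simp only [Drw]; push_cast; ring

lemma rwVar_eq (p : ℝ × ℝ) (hD : Drw p ≠ 0) :
    rwVar p = 1 - 2 * ((Real.sqrt 7 : ℂ) + 11 * I) / Drw p := by
  rw [rwVar, Drw_neg]; field_simp; ring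

/-- Differentiating `m` along a curve on which `D` has derivative `k (√7 + 11i)`. -/
lemma hasDerivAt_rwVar {γ : ℝ → ℝ × ℝ} {d k : ℂ} {y : ℝ}
    (hγ : HasDerivAt (fun z => Drw (γ z)) d y) (hD : Drw (γ y) ≠ 0)
    (hd : d = k * ((Real.sqrt 7 : ℂ) + 11 * I)) :
    HasDerivAt (fun z => rwVar (γ z)) (k / 2 * (1 - rwVar (γ y)) ^ 2) y := by
  have h : HasDerivAt (fun z => -(2 * ((Real.sqrt 7 : ℂ) + 11 * I) - Drw (γ z)) / Drw (γ z))
      _ y := (hγ.const_sub _).neg.div hγ hD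
  simp only [← Drw_neg] at h
  refine h.congr_deriv ?_
  rw [rwVar_eq _ hD, Pi.neg_apply, Drw_neg, hd]
  field_simp
  ring

lemma hasDerivAt_rwFun {γ : ℝ → ℝ × ℝ} {e k : ℂ} {y : ℝ} (P : ℂ[X])
    (hE : HasDerivAt (fun z => rwPhase (γ z)) (rwPhase (γ y) * e) y)
    (hm : HasDerivAt (fun z => rwVar (γ z)) (k / 2 * (1 - rwVar (γ y)) ^ 2) y) :
    HasDerivAt (fun z => rwFun P (γ z))
      (rwFun (C e * P + C (k / 2) * (1 - X) ^ 2 * derivative P) (γ y)) y := by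
  have h := hE.mul ((P.hasDerivAt (rwVar (γ y))).comp y hm)
  refine h.congr_deriv ?_
  simp only [rwFun, eval_add, eval_mul, eval_C, eval_pow, eval_sub, eval_one, eval_X,
    Function.comp]
  ring

lemma hasDerivAt_rwFun_x (P : ℂ[X]) (p : ℝ × ℝ) (hD : Drw p ≠ 0) :
    HasDerivAt (fun x => rwFun P (x, p.2)) (-I * rwFun (rwDx P) p) p.1 := by
  have hE : HasDerivAt (fun x : ℝ => rwPhase (x, p.2)) (rwPhase p * (-2 * I)) p.1 := by
    have h := ((((hasDerivAt_id p.1).ofReal_comp).const_sub (9 * (p.2 : ℂ))).const_mul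
      (2 * I)).cexp
    refine h.congr_deriv ?_
    simp [rwPhase]
  have hm := hasDerivAt_rwVar (γ := fun x => (x, p.2)) (k := -I * (rwRoot + 7))
    (hasDerivAt_Drw_x p.1 p.2) hD (by
      have hs := sq_sqrt_seven
      have hI := I_sq
      simp only [rwRoot]
      generalize (Real.sqrt 7 : ℂ) = s at *
      generalize I = i at *
      grind)
  refine (hasDerivAt_rwFun P hE hm).congr_deriv ?_
  simp only [rwFun, rwDx, eval_add, eval_mul, eval_C, eval_pow, eval_sub, eval_one, eval_X,
    eval_ofNat]
  ring

lemma hasDerivAt_rwFun_t (P : ℂ[X]) (p : ℝ × ℝ) (hD : Drw p ≠ 0) :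
    HasDerivAt (fun t => rwFun P (p.1, t)) (-I * rwFun (rwDt P) p) p.2 := by
  have hE : HasDerivAt (fun t : ℝ => rwPhase (p.1, t)) (rwPhase p * (18 * I)) p.2 := by
    have h := (((((hasDerivAt_id p.2).ofReal_comp).const_mul (9 : ℂ)).sub_const
      (p.1 : ℂ)).const_mul (2 * I)).cexp
    refine h.congr_deriv ?_
    simp [rwPhase]
    ring
  have hm := hasDerivAt_rwVar (γ := fun t => (p.1, t)) (k := -I * ((55 * rwRoot - 175) / 2))
    (hasDerivAt_Drw_t p.1 p.2) hD (by
      have hs := sq_sqrt_seven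
      have hI := I_sq
      simp only [rwRoot]
      generalize (Real.sqrt 7 : ℂ) = s at *
      generalize I = i at *
      grind)
  refine (hasDerivAt_rwFun P hE hm).congr_deriv ?_
  simp only [rwFun, rwDt, eval_add, eval_mul, eval_C, eval_pow, eval_sub, eval_one, eval_X,
    eval_ofNat, eval_neg]
  ring

lemma eventually_Drw_ne_zero (p : ℝ × ℝ) (hD : Drw p ≠ 0) :
    ∀ᶠ x in nhds p.1, Drw (x, p.2) ≠ 0 :=
  (hasDerivAt_Drw_x p.1 p.2).continuousAt.eventually_ne hD

lemma hasDerivAt_of_eq_rwFun {f : ℝ × ℝ → ℂ} {a : ℂ} {P : ℂ[X]}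
    (hf : ∀ p, Drw p ≠ 0 → f p = a * rwFun P p) (p : ℝ × ℝ) (hD : Drw p ≠ 0) :
    HasDerivAt (fun x => f (x, p.2)) (-I * a * rwFun (rwDx P) p) p.1 := by
  have h := (hasDerivAt_rwFun_x P p hD).const_mul a
  refine (h.congr_of_eventuallyEq ?_).congr_deriv (by ring)
  filter_upwards [eventually_Drw_ne_zero p hD] with x hx using hf _ hx

lemma rwDx_rwPoly : rwDx rwPoly =
      C (-7 + 3 * rwRoot) + C (19 - 11 * rwRoot) * X + C (-21 + 15 * rwRoot) * X ^ 2
        + C (7 - 7 * rwRoot) * X ^ 3 := by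
  have hj := rwRoot_sq
  refine Polynomial.funext fun m => ?_
  rw [rwDx, rwPoly]
  simp only [derivative_add, derivative_mul, derivative_neg, derivative_C, derivative_X,
    eval_add, eval_mul, eval_neg, eval_C, eval_X, eval_pow, eval_sub,
    eval_one, eval_ofNat, eval_zero]
  generalize rwRoot = j at *
  grind

lemma rwDx_rwDx_rwPoly : rwDx (rwDx rwPoly) =
      C (91 - 23 * rwRoot) + C (-424 + 120 * rwRoot) * X + C (714 - 230 * rwRoot) * X ^ 2
        + C (-532 + 196 * rwRoot) * X ^ 3 + C (147 - 63 * rwRoot) * X ^ 4 := by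
  have hj := rwRoot_sq
  refine Polynomial.funext fun m => ?_
  rw [rwDx_rwPoly, rwDx]
  simp only [derivative_add, derivative_mul, derivative_C, derivative_X,
    derivative_X_pow, eval_add, eval_mul, eval_C, eval_X, eval_pow, eval_sub,
    eval_one, eval_ofNat, eval_zero, Nat.cast_ofNat]
  generalize rwRoot = j at *
  grind

lemma rwDx_rwDx_rwDx_rwPoly : rwDx (rwDx (rwDx rwPoly)) =
      C (-1722 + 162 * rwRoot) + C (9568 - 1072 * rwRoot) * X
        + C (-21336 + 2800 * rwRoot) * X ^ 2 + C (23772 - 3612 * rwRoot) * X ^ 3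
        + C (-13230 + 2310 * rwRoot) * X ^ 4 + C (2940 - 588 * rwRoot) * X ^ 5 := by
  have hj := rwRoot_sq
  refine Polynomial.funext fun m => ?_
  rw [rwDx_rwDx_rwPoly, rwDx]
  simp only [derivative_add, derivative_mul, derivative_C, derivative_X,
    derivative_X_pow, eval_add, eval_mul, eval_C, eval_X, eval_pow, eval_sub,
    eval_one, eval_ofNat, eval_zero, Nat.cast_ofNat]
  generalize rwRoot = j at *
  grind

lemma rwDt_rwPoly : rwDt rwPoly =
      C ((-105 - 115 * rwRoot) / 2) + C ((631 + 369 * rwRoot) / 2) * X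
        + C ((-875 - 429 * rwRoot) / 2) * X ^ 2 + C ((385 + 175 * rwRoot) / 2) * X ^ 3 := by
  have hj := rwRoot_sq
  refine Polynomial.funext fun m => ?_
  rw [rwDt, rwPoly]
  simp only [derivative_add, derivative_mul, derivative_neg, derivative_C, derivative_X,
    eval_add, eval_mul, eval_neg, eval_C, eval_X, eval_pow, eval_sub,
    eval_one, eval_ofNat, eval_zero]
  generalize rwRoot = j at *
  grind

/-- The equation for the rogue wave, after division by the phase, in the variable `m`. -/
lemma rwPoly_identity {m n f₀ f₁ f₂ f₃ g F₀ F₁ : ℂ} (hmn : m * n = 1)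
    (h₀ : f₀ = rwPoly.eval m) (h₁ : f₁ = (rwDx rwPoly).eval m)
    (h₂ : f₂ = (rwDx (rwDx rwPoly)).eval m) (h₃ : f₃ = (rwDx (rwDx (rwDx rwPoly))).eval m)
    (hg : g = (rwDt rwPoly).eval m) (k₀ : F₀ = rwPoly.eval n) (k₁ : F₁ = (rwDx rwPoly).eval n) :
    g - f₃ - 3 * (-(f₁ ^ 2 * F₀) + f₀ * f₁ * F₁ - f₀ * F₀ * f₂
        + (3 / 2 * f₀ ^ 2 * f₁ * F₀ ^ 2 - f₀ ^ 3 * F₀ * F₁))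
      + (-2 * f₂ - 3 * f₀ ^ 3 * F₀ ^ 2) + (-2 * f₀ ^ 2 * F₁ + 10 * f₀ * F₀ * f₁)
      + (4 * f₀ ^ 2 * F₀ + 4 * f₁ - 8 * f₀) + 8 * f₀ = 0 := by
  have hj := rwRoot_sq
  rw [rwDx_rwPoly] at h₁ k₁
  rw [rwDx_rwDx_rwPoly] at h₂
  rw [rwDx_rwDx_rwDx_rwPoly] at h₃
  rw [rwDt_rwPoly] at hg
  rw [rwPoly] at h₀ k₀
  simp only [eval_add, eval_mul, eval_neg, eval_C, eval_X, eval_pow] at h₀ h₁ h₂ h₃ hg k₀ k₁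
  generalize rwRoot = j at *
  subst h₀ h₁ h₂ h₃ hg k₀ k₁
  grind

/-- the first-order rogue wave solves the nonlocal equation (E)
with `ρ = 1` at every point where `D(x,t) ≠ 0` and `D(-x,-t) ≠ 0`. -/
theorem first_order_rogue_wave_solves_nonlocal_equation :
    ∀ p : ℝ × ℝ, Drw p ≠ 0 → Drw (-p.1, -p.2) ≠ 0 → NonlocalEAt qRogue 1 p := by
  intro p hD hD'
  have hm : rwVar p ≠ 0 := div_ne_zero (neg_ne_zero.2 hD') hD
  have h1 : ∀ p, Drw p ≠ 0 → pdx qRogue p = -I * rwFun (rwDx rwPoly) p := fun p hp => by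
    rw [qRogue_eq]; exact (hasDerivAt_rwFun_x _ p hp).deriv
  have h2 : ∀ p, Drw p ≠ 0 → pdx (pdx qRogue) p = -1 * rwFun (rwDx (rwDx rwPoly)) p :=
    fun p hp => by
      rw [pdx, (hasDerivAt_of_eq_rwFun h1 p hp).deriv]
      linear_combination rwFun (rwDx (rwDx rwPoly)) p * I_sq
  have h3 : pdx (pdx (pdx qRogue)) p = I * rwFun (rwDx (rwDx (rwDx rwPoly))) p := by
    rw [pdx, (hasDerivAt_of_eq_rwFun h2 p hD).deriv]; ring
  have ht : pdt qRogue p = -I * rwFun (rwDt rwPoly) p := by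
    rw [qRogue_eq]; exact (hasDerivAt_rwFun_t _ p hD).deriv
  have hh : hq1 qRogue p = -I * ((rwPhase p)⁻¹ * (rwDx rwPoly).eval (rwVar p)⁻¹) := by
    rw [hq1, h1 _ hD', rwFun, rwPhase_neg, rwVar_neg]
  have hT : tq qRogue p = (rwPhase p)⁻¹ * rwPoly.eval (rwVar p)⁻¹ := by
    rw [tq, qRogue_eq, rwFun, rwPhase_neg, rwVar_neg]
  have h0 : qRogue p = rwFun rwPoly p := by rw [qRogue_eq]
  have d0 : HasDerivAt (fun x => qRogue (x, p.2)) (pdx qRogue p) p.1 := by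
    rw [h1 p hD, qRogue_eq]; exact hasDerivAt_rwFun_x _ p hD
  have d1 : HasDerivAt (fun x => pdx qRogue (x, p.2)) (pdx (pdx qRogue) p) p.1 :=
    (hasDerivAt_of_eq_rwFun h1 p hD).differentiableAt.hasDerivAt
  have dT : HasDerivAt (fun x => tq qRogue (x, p.2)) (-hq1 qRogue p) p.1 := by
    have h : HasDerivAt (fun x => qRogue (x, -p.2)) (hq1 qRogue p) (-p.1) := by
      rw [hq1, h1 _ hD', qRogue_eq]; exact hasDerivAt_rwFun_x _ (-p.1, -p.2) hD'
    exact (h.scomp p.1 (hasDerivAt_neg p.1)).congr_deriv (by simp)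
  have d : pdx (fun p' => qRogue p' * tq qRogue p' * pdx qRogue p'
      + (I / 2) * (qRogue p') ^ 3 * (tq qRogue p') ^ 2) p = _ :=
    (((d0.mul dT).mul d1).add (((d0.pow 3).const_mul (I / 2)).mul (dT.pow 2))).deriv
  have key := rwPoly_identity (mul_inv_cancel₀ hm) rfl rfl rfl rfl rfl rfl rfl
  rw [NonlocalEAt, d]
  simp only [Pi.mul_apply, Pi.pow_apply, Prod.mk.eta, h3, h2 p hD, h1 p hD, ht, hh, hT, h0, rwFun]
  have hE := mul_inv_cancel₀ (rwPhase_ne_zero p)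
  have hI := I_sq
  clear d dT d0 d1 h0 h1 h2 h3 ht hh hT
  generalize (rwPhase p)⁻¹ = E' at *
  generalize rwPhase p = E at *
  generalize I = i at *
  generalize eval (rwVar p) (rwDx (rwDx (rwDx rwPoly))) = f₃ at *
  generalize eval (rwVar p) (rwDx (rwDx rwPoly)) = f₂ at *
  generalize eval (rwVar p) (rwDx rwPoly) = f₁ at *
  generalize eval (rwVar p) rwPoly = f₀ at *
  generalize eval (rwVar p) (rwDt rwPoly) = g at *
  generalize eval (rwVar p)⁻¹ (rwDx rwPoly) = F₁ at *
  generalize eval (rwVar p)⁻¹ rwPoly = F₀ at *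
  norm_num
  grind
end
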